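/- arXiv:2602.05906 — 4 statements merged into one kernel-verified Lean document; each statement's English description precedes it below -/
import Mathlib

section
/- For every integer n ≥ 0, the functions C_τ^{a,b} and S_τ^{a,b} are infinitely differentiable on the open interval (nτ, (n+1)τ); moreover, C_τ^{a,b}, S_τ^{a,b} and their first derivatives are continuous on [0, ∞). -/
/-- Single term of the double series defining the delayed perturbation cosine function. -/
noncomputable def Cterm (τ a b t : ℝ) (k m : ℕ) : ℝ :=
  if k ≤ m then
    (m.choose k : ℝ) * a ^ (m - k) * b ^ k * (max (t - (k : ℝ) * τ) 0) ^ (2 * m) /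
      (Nat.factorial (2 * m) : ℝ)
  else 0

/-- Single term of the double series defining the delayed perturbation sine function. -/
noncomputable def Sterm (τ a b t : ℝ) (k m : ℕ) : ℝ :=
  if k ≤ m then
    (m.choose k : ℝ) * a ^ (m - k) * b ^ k * (max (t - (k : ℝ) * τ) 0) ^ (2 * m + 1) /
      (Nat.factorial (2 * m + 1) : ℝ)
  else 0

/-- The delayed perturbation cosine-type function `C_τ^{a,b}`, extended by `0` for `t < 0`. -/
noncomputable def Cdel (τ a b : ℝ) (t : ℝ) : ℝ :=
  if t < 0 then 0 else ∑' k : ℕ, ∑' m : ℕ, Cterm τ a b t k m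

/-- The delayed perturbation sine-type function `S_τ^{a,b}`, extended by `0` for `t < 0`. -/
noncomputable def Sdel (τ a b : ℝ) (t : ℝ) : ℝ :=
  if t < 0 then 0 else ∑' k : ℕ, ∑' m : ℕ, Sterm τ a b t k m

open scoped ContDiff

/-- A scalar power series whose coefficients are absolutely summable against every geometric
sequence defines a smooth function on the real line. -/
lemma contDiff_tsum_mul_pow {c : ℕ → ℝ}
    (hc : ∀ r : ℝ, 0 ≤ r → Summable fun m => ‖c m‖ * r ^ m) :
    ContDiff ℝ ∞ fun y : ℝ => ∑' m, c m * y ^ m := by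
  have hrad : (FormalMultilinearSeries.ofScalars ℝ c).radius = ⊤ := by
    refine FormalMultilinearSeries.radius_eq_top_of_summable_norm _ fun r => ?_
    simpa only [FormalMultilinearSeries.ofScalars_norm] using hc r r.2
  have h := (FormalMultilinearSeries.ofScalars ℝ c).hasFPowerSeriesOnBall (by simp [hrad])
  rw [hrad] at h
  have hA : AnalyticOnNhd ℝ (FormalMultilinearSeries.ofScalars ℝ c).sum Set.univ := by
    simpa using h.analyticOnNhd
  have hsum : (FormalMultilinearSeries.ofScalars ℝ c).sum = fun y : ℝ => ∑' m, c m * y ^ m := by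
    funext y
    simp [FormalMultilinearSeries.sum, mul_comm]
  rw [← hsum]
  exact contDiffOn_univ.1 hA.contDiffOn_of_completeSpace

/-- The coefficient `binom(m,k) a^(m-k) b^k`, extended by zero to `m < k`. -/
noncomputable def delayCoeff (a b : ℝ) (k m : ℕ) : ℝ :=
  if k ≤ m then (m.choose k : ℝ) * a ^ (m - k) * b ^ k else 0

lemma norm_delayCoeff_le (a b : ℝ) (k m : ℕ) : ‖delayCoeff a b k m‖ ≤ (|b| + |a|) ^ m := by
  unfold delayCoeff
  split_ifs with h
  · rw [add_pow]
    refine le_trans (le_of_eq ?_) (Finset.single_le_sum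
      (f := fun i => |b| ^ i * |a| ^ (m - i) * (m.choose i : ℝ))
      (fun i _ => by positivity) (Finset.mem_range.2 (Nat.lt_succ_of_le h)))
    simp only [Real.norm_eq_abs, abs_mul, abs_pow, Nat.abs_cast]
    ring
  · simp only [norm_zero]
    positivity

/-- The power series `∑ m, binom(m,k) a^(m-k) b^k y^m / (2m+e)!`. -/
noncomputable def delaySeries (a b : ℝ) (e k : ℕ) (y : ℝ) : ℝ :=
  ∑' m : ℕ, delayCoeff a b k m / (Nat.factorial (2 * m + e) : ℝ) * y ^ m

lemma contDiff_delaySeries (a b : ℝ) (e k : ℕ) : ContDiff ℝ ∞ (delaySeries a b e k) := by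
  refine contDiff_tsum_mul_pow fun r hr => ?_
  refine Summable.of_nonneg_of_le (fun m => by positivity) (fun m => ?_)
    (Real.summable_pow_div_factorial ((|b| + |a|) * r))
  have hfac : (m.factorial : ℝ) ≤ ((2 * m + e).factorial : ℝ) := by
    exact_mod_cast Nat.factorial_le (by omega)
  rw [norm_div, Real.norm_natCast, mul_pow, div_mul_eq_mul_div]
  have := norm_delayCoeff_le a b k m
  gcongr

lemma delaySeries_zero (a b : ℝ) (e : ℕ) {k : ℕ} (hk : k ≠ 0) : delaySeries a b e k 0 = 0 := by
  have h (m : ℕ) : delayCoeff a b k m / (Nat.factorial (2 * m + e) : ℝ) * (0 : ℝ) ^ m = 0 := by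
    rcases Nat.eq_zero_or_pos m with rfl | hm
    · simp [delayCoeff, hk]
    · simp [hm.ne']
  simp [delaySeries, h]

lemma tsum_Cterm (τ a b t : ℝ) (k : ℕ) :
    ∑' m, Cterm τ a b t k m = delaySeries a b 0 k (max (t - k * τ) 0 ^ 2) := by
  refine tsum_congr fun m => ?_
  unfold Cterm delayCoeff
  split_ifs <;> simp [pow_mul]
  ring

lemma tsum_Sterm (τ a b t : ℝ) (k : ℕ) :
    ∑' m, Sterm τ a b t k m =
      max (t - k * τ) 0 * delaySeries a b 1 k (max (t - k * τ) 0 ^ 2) := by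
  rw [delaySeries, ← tsum_mul_left]
  refine tsum_congr fun m => ?_
  unfold Sterm delayCoeff
  split_ifs <;> simp [pow_succ, pow_mul]
  ring

/-- Precomposing with the positive part keeps `C¹` regularity if the derivative
vanishes at the origin. -/
lemma ContDiff.comp_max_zero {g : ℝ → ℝ} (hg : ContDiff ℝ 1 g)
    (h1 : deriv g 0 = 0) : ContDiff ℝ 1 fun x => g (max x 0) := by
  have hd (x : ℝ) : HasDerivAt g (deriv g x) x :=
    (hg.differentiable one_ne_zero x).hasDerivAt
  have key (x : ℝ) : HasDerivAt (fun x => g (max x 0)) (deriv g (max x 0)) x := by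
    rcases lt_trichotomy x 0 with hx | rfl | hx
    · rw [max_eq_right hx.le, h1]
      refine (hasDerivAt_const x (g 0)).congr_of_eventuallyEq ?_
      filter_upwards [Iio_mem_nhds hx] with y hy
      rw [max_eq_right (le_of_lt hy)]
    · rw [max_self, h1]
      have hl : HasDerivWithinAt (fun x => g (max x 0)) 0 (Set.Iic 0) 0 :=
        (hasDerivWithinAt_const 0 _ (g 0)).congr
          (fun y hy => by rw [max_eq_right (Set.mem_Iic.1 hy)]) (by simp)
      have hr : HasDerivWithinAt (fun x => g (max x 0)) 0 (Set.Ici 0) 0 :=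
        (h1 ▸ hd 0).hasDerivWithinAt.congr
          (fun y hy => by rw [max_eq_left (Set.mem_Ici.1 hy)]) (by simp)
      simpa [Set.Iic_union_Ici] using hl.union hr
    · rw [max_eq_left hx.le]
      refine (hd x).congr_of_eventuallyEq ?_
      filter_upwards [Ioi_mem_nhds hx] with y hy
      rw [max_eq_left (le_of_lt hy)]
  rw [contDiff_one_iff_deriv]
  refine ⟨fun x => (key x).differentiableAt, ?_⟩
  rw [funext fun x => (key x).deriv]
  exact (hg.continuous_deriv le_rfl).comp (continuous_id.max continuous_const)

/-- A superposition of delayed profiles is locally a finite sum. -/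
lemma tsum_delayed_eq_sum {τ : ℝ} (hτ : 0 < τ) {g : ℕ → ℝ → ℝ}
    (h0 : ∀ k, k ≠ 0 → g k 0 = 0) {N : ℕ} {t : ℝ} (ht0 : 0 ≤ t) (ht : t ≤ (N + 1) * τ) :
    ∑' k : ℕ, g k (max (t - k * τ) 0) =
      g 0 t + ∑ k ∈ Finset.range N, g (k + 1) (max (t - (k + 1 : ℕ) * τ) 0) := by
  rw [tsum_eq_sum (s := Finset.range (N + 1)), Finset.sum_range_succ', add_comm]
  · simp [ht0]
  · intro k hk
    have hk' : N + 1 ≤ k := by simpa using hk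
    have hk2 : ((N : ℝ) + 1) * τ ≤ k * τ := by
      gcongr
      exact_mod_cast hk'
    rw [max_eq_right (by linarith), h0 k (by omega)]

lemma contDiffOn_delayed_Ioo {τ : ℝ} (hτ : 0 < τ) {g : ℕ → ℝ → ℝ}
    (hg : ∀ k, ContDiff ℝ ∞ (g k)) (h0 : ∀ k, k ≠ 0 → g k 0 = 0) {F : ℝ → ℝ}
    (hF : ∀ t, 0 ≤ t → F t = ∑' k : ℕ, g k (max (t - k * τ) 0)) (n : ℕ) :
    ContDiffOn ℝ ∞ F (Set.Ioo ((n : ℝ) * τ) (((n : ℝ) + 1) * τ)) := by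
  have hsmooth : ContDiff ℝ ∞ fun t : ℝ =>
      g 0 t + ∑ k ∈ Finset.range n, g (k + 1) (t - (k + 1 : ℕ) * τ) :=
    (hg 0).add (ContDiff.sum fun k _ => (hg (k + 1)).comp (contDiff_id.sub contDiff_const))
  refine hsmooth.contDiffOn.congr fun t ht => ?_
  have ht0 : 0 ≤ t := le_trans (by positivity) ht.1.le
  rw [hF t ht0, tsum_delayed_eq_sum hτ h0 ht0 ht.2.le]
  refine congrArg _ (Finset.sum_congr rfl fun k hk => ?_)
  have hk : ((k + 1 : ℕ) : ℝ) * τ ≤ n * τ := by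
    gcongr
    exact Finset.mem_range.1 hk
  rw [max_eq_left (by linarith [ht.1])]

lemma contDiffOn_one_delayed_Ici {τ : ℝ} (hτ : 0 < τ) {g : ℕ → ℝ → ℝ}
    (hg : ∀ k, ContDiff ℝ 1 (g k)) (h0 : ∀ k, k ≠ 0 → g k 0 = 0)
    (h1 : ∀ k, k ≠ 0 → deriv (g k) 0 = 0) {F : ℝ → ℝ}
    (hF : ∀ t, 0 ≤ t → F t = ∑' k : ℕ, g k (max (t - k * τ) 0)) :
    ContDiffOn ℝ 1 F (Set.Ici 0) := by
  intro t ht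
  obtain ⟨N, hN⟩ := exists_nat_gt (t / τ)
  have htN : t < (N + 1) * τ := by
    rw [div_lt_iff₀ hτ] at hN
    linarith
  have hsmooth : ContDiff ℝ 1 fun t : ℝ =>
      g 0 t + ∑ k ∈ Finset.range N, g (k + 1) (max (t - (k + 1 : ℕ) * τ) 0) :=
    (hg 0).add (ContDiff.sum fun k _ =>
      ((hg (k + 1)).comp_max_zero (h1 _ k.succ_ne_zero)).comp
        (contDiff_id.sub contDiff_const))
  refine hsmooth.contDiffWithinAt.congr_of_eventuallyEq_of_mem ?_ ht
  filter_upwards [self_mem_nhdsWithin, mem_nhdsWithin_of_mem_nhds (Iio_mem_nhds htN)] with s hs hs'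
  rw [hF s hs, tsum_delayed_eq_sum hτ h0 hs (le_of_lt hs')]

/-- for every integer `n ≥ 0`, `C_τ^{a,b}` and `S_τ^{a,b}` are infinitely
differentiable on `(nτ, (n+1)τ)`; moreover `C_τ^{a,b}`, `S_τ^{a,b}` and their first
(one-sided at `0`) derivatives are continuous on `[0, ∞)`. -/
theorem delayedPerturbation_smoothness (τ a b : ℝ) (hτ : 0 < τ) :
    (∀ n : ℕ,
      ContDiffOn ℝ (⊤ : ℕ∞) (Cdel τ a b) (Set.Ioo ((n : ℝ) * τ) (((n : ℝ) + 1) * τ)) ∧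
      ContDiffOn ℝ (⊤ : ℕ∞) (Sdel τ a b) (Set.Ioo ((n : ℝ) * τ) (((n : ℝ) + 1) * τ))) ∧
    ContinuousOn (Cdel τ a b) (Set.Ici (0 : ℝ)) ∧
    ContinuousOn (Sdel τ a b) (Set.Ici (0 : ℝ)) ∧
    DifferentiableOn ℝ (Cdel τ a b) (Set.Ici (0 : ℝ)) ∧
    DifferentiableOn ℝ (Sdel τ a b) (Set.Ici (0 : ℝ)) ∧
    ContinuousOn (derivWithin (Cdel τ a b) (Set.Ici (0 : ℝ))) (Set.Ici (0 : ℝ)) ∧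
    ContinuousOn (derivWithin (Sdel τ a b) (Set.Ici (0 : ℝ))) (Set.Ici (0 : ℝ)) := by
  have hser (e k : ℕ) : ContDiff ℝ ∞ fun x : ℝ => delaySeries a b e k (x ^ 2) :=
    (contDiff_delaySeries a b e k).comp (contDiff_id.pow 2)
  have hsq (e k : ℕ) : HasDerivAt (fun x : ℝ => delaySeries a b e k (x ^ 2)) 0 0 := by
    have h := ((contDiff_delaySeries a b e k).differentiable (by simp) (0 ^ 2)).hasDerivAt.comp
      (0 : ℝ) (hasDerivAt_pow 2 (0 : ℝ))
    simpa [Function.comp_def] using h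
  have hCg (k : ℕ) := hser 0 k
  have hC0 (k : ℕ) (hk : k ≠ 0) : delaySeries a b 0 k (0 ^ 2) = 0 := by
    simpa using delaySeries_zero a b 0 hk
  have hCF (t : ℝ) (ht : 0 ≤ t) :
      Cdel τ a b t = ∑' k : ℕ, delaySeries a b 0 k (max (t - k * τ) 0 ^ 2) := by
    simp [Cdel, ht.not_gt, tsum_Cterm]
  have hSg (k : ℕ) : ContDiff ℝ ∞ fun x : ℝ => x * delaySeries a b 1 k (x ^ 2) :=
    contDiff_id.mul (hser 1 k)
  have hS0 (k : ℕ) (_ : k ≠ 0) : (0 : ℝ) * delaySeries a b 1 k (0 ^ 2) = 0 := zero_mul _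
  have hS1 (k : ℕ) (hk : k ≠ 0) : deriv (fun x : ℝ => x * delaySeries a b 1 k (x ^ 2)) 0 = 0 := by
    have h := ((hasDerivAt_id (0 : ℝ)).mul (hsq 1 k)).deriv
    simpa [Pi.mul_def, delaySeries_zero a b 1 hk] using h
  have hSF (t : ℝ) (ht : 0 ≤ t) : Sdel τ a b t =
      ∑' k : ℕ, max (t - k * τ) 0 * delaySeries a b 1 k (max (t - k * τ) 0 ^ 2) := by
    simp [Sdel, ht.not_gt, tsum_Sterm]
  have hC := contDiffOn_one_delayed_Ici hτ (g := fun k x => delaySeries a b 0 k (x ^ 2))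
    (fun k => (hCg k).of_le (by simp)) hC0 (fun k _ => (hsq 0 k).deriv) hCF
  have hS := contDiffOn_one_delayed_Ici hτ (g := fun k x => x * delaySeries a b 1 k (x ^ 2))
    (fun k => (hSg k).of_le (by simp)) hS0 hS1 hSF
  exact ⟨fun n =>
    ⟨contDiffOn_delayed_Ioo hτ (g := fun k x => delaySeries a b 0 k (x ^ 2)) hCg hC0 hCF n,
      contDiffOn_delayed_Ioo hτ (g := fun k x => x * delaySeries a b 1 k (x ^ 2)) hSg hS0 hSF n⟩,
    hC.continuousOn, hS.continuousOn, hC.differentiableOn one_ne_zero,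
    hS.differentiableOn one_ne_zero,
    hC.continuousOn_derivWithin (uniqueDiffOn_Ici 0) le_rfl,
    hS.continuousOn_derivWithin (uniqueDiffOn_Ici 0) le_rfl⟩
end

section
/- For every integer n ≥ 0 and every t in the open interval (nτ, (n+1)τ), the second derivative of C_τ^{a,b} exists at t and satisfies the homogeneous delay differential equation (d²/dt²)C_τ^{a,b}(t) = a·C_τ^{a,b}(t) + b·C_τ^{a,b}(t-τ), where C_τ^{a,b}(s) = 0 for s < 0 by convention (in particular, on (0,τ) the identity reads (d²/dt²)C_τ^{a,b}(t) = a·C_τ^{a,b}(t)). -/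
/-- The exponential generating function `∑ d n * x ^ n / n!` of a real sequence. -/
noncomputable def expGenFun (d : ℕ → ℝ) (x : ℝ) : ℝ :=
  ∑' n : ℕ, d n * x ^ n / (n.factorial : ℝ)

theorem summable_expGenFun {d : ℕ → ℝ} {M K : ℝ} (hd : ∀ n, |d n| ≤ M * K ^ n) (x : ℝ) :
    Summable fun n : ℕ => d n * x ^ n / (n.factorial : ℝ) := by
  refine Summable.of_norm_bounded ((Real.summable_pow_div_factorial (K * |x|)).mul_left M) ?_
  intro n
  rw [Real.norm_eq_abs, abs_div, abs_mul, abs_pow, Nat.abs_cast, mul_pow, ← mul_div_assoc,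
    ← mul_assoc]
  gcongr
  exact hd n

/-- Differentiating an exponential generating function shifts the sequence. -/
theorem hasDerivAt_expGenFun {d : ℕ → ℝ} {M K : ℝ} (hd : ∀ n, |d n| ≤ M * K ^ n) (x : ℝ) :
    HasDerivAt (expGenFun d) (expGenFun (fun n => d (n + 1)) x) x := by
  have hfac : ∀ (n : ℕ) (y : ℝ), d (n + 1) * (((n + 1 : ℕ) : ℝ) * y ^ n) /
      ((n + 1).factorial : ℝ) = d (n + 1) * y ^ n / (n.factorial : ℝ) := by
    intro n y
    rw [Nat.factorial_succ]
    push_cast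
    have h1 : (n : ℝ) + 1 ≠ 0 := by positivity
    have h2 : (n.factorial : ℝ) ≠ 0 := by positivity
    field_simp
  have hd' : ∀ n, |d (n + 1)| ≤ M * K * K ^ n := fun n => by
    simpa [pow_succ', mul_assoc] using hd (n + 1)
  set R : ℝ := |x| + 1
  have hu : Summable fun n : ℕ => |d n| * ((n : ℝ) * R ^ (n - 1)) / (n.factorial : ℝ) := by
    rw [← summable_nat_add_iff 1]
    refine (summable_expGenFun (d := fun n => |d (n + 1)|) (M := M * K) (K := K)
      (fun n => by simpa using hd' n) R).congr fun n => ?_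
    rw [Nat.factorial_succ, Nat.add_sub_cancel]
    push_cast
    have h1 : (n : ℝ) + 1 ≠ 0 := by positivity
    have h2 : (n.factorial : ℝ) ≠ 0 := by positivity
    field_simp
  have key := hasDerivAt_tsum_of_isPreconnected
    (g := fun (n : ℕ) y => d n * y ^ n / (n.factorial : ℝ))
    (g' := fun (n : ℕ) y => d n * ((n : ℝ) * y ^ (n - 1)) / (n.factorial : ℝ))
    (t := Metric.ball (0 : ℝ) R) (y₀ := x) (y := x) hu Metric.isOpen_ball
    (convex_ball (0 : ℝ) R).isPreconnected
    (fun n y _ => ((hasDerivAt_pow n y).const_mul (d n)).div_const _)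
    (fun n y hy => by
      have hy' : |y| ≤ R := by simpa using (mem_ball_zero_iff.mp hy).le
      rw [Real.norm_eq_abs, abs_div, abs_mul, abs_mul, abs_pow, Nat.abs_cast, Nat.abs_cast]
      gcongr)
    (by simp [R]) (summable_expGenFun hd x) (by simp [R])
  refine key.congr_deriv ?_
  have hs : Summable fun n : ℕ => d n * ((n : ℝ) * x ^ (n - 1)) / (n.factorial : ℝ) := by
    rw [← summable_nat_add_iff 1]
    refine (summable_expGenFun hd' x).congr fun n => ?_
    simpa using (hfac n x).symm
  rw [hs.tsum_eq_zero_add]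
  simp only [Nat.cast_zero, zero_mul, mul_zero, zero_div, zero_add, Nat.add_sub_cancel]
  exact tsum_congr fun n => hfac n x

/-- The Taylor coefficients at `0` of the inner series of `Cdel`, as a function of `t - k * τ`. -/
noncomputable def cosCoeff (a b : ℝ) (k n : ℕ) : ℝ :=
  if Even n then ((n / 2).choose k : ℝ) * a ^ (n / 2 - k) * b ^ k else 0

theorem abs_cosCoeff_le (a b : ℝ) (k n : ℕ) :
    |cosCoeff a b k n| ≤ 1 * (2 * (1 + |a| + |b|)) ^ n := by
  have ha := abs_nonneg a
  have hb := abs_nonneg b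
  have hL : 1 ≤ 1 + |a| + |b| := by linarith
  rw [one_mul]
  unfold cosCoeff
  split_ifs
  · rcases le_or_gt k (n / 2) with hk | hk
    · rw [abs_mul, abs_mul, abs_pow, abs_pow, Nat.abs_cast]
      calc ((n / 2).choose k : ℝ) * |a| ^ (n / 2 - k) * |b| ^ k
          ≤ 2 ^ (n / 2) * (1 + |a| + |b|) ^ (n / 2 - k) * (1 + |a| + |b|) ^ k := by
            gcongr
            · exact_mod_cast Nat.choose_le_two_pow (n / 2) k
            · linarith
            · linarith
        _ = (2 * (1 + |a| + |b|)) ^ (n / 2) := by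
            rw [mul_assoc, ← pow_add, Nat.sub_add_cancel hk, mul_pow]
        _ ≤ (2 * (1 + |a| + |b|)) ^ n :=
            pow_le_pow_right₀ (by linarith) (Nat.div_le_self n 2)
    · rw [Nat.choose_eq_zero_of_lt hk]
      simp only [Nat.cast_zero, zero_mul, abs_zero]
      positivity
  · rw [abs_zero]
    positivity

theorem cosCoeff_zero_add_two (a b : ℝ) (n : ℕ) :
    cosCoeff a b 0 (n + 2) = a * cosCoeff a b 0 n := by
  unfold cosCoeff
  have h : (n + 2) / 2 = n / 2 + 1 := by omega
  simp only [Nat.even_add, even_two, iff_true, h]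
  split_ifs <;> simp [pow_succ']

theorem cosCoeff_succ_add_two (a b : ℝ) (k n : ℕ) :
    cosCoeff a b (k + 1) (n + 2) = a * cosCoeff a b (k + 1) n + b * cosCoeff a b k n := by
  unfold cosCoeff
  have h : (n + 2) / 2 = n / 2 + 1 := by omega
  simp only [Nat.even_add, even_two, iff_true, h]
  split_ifs
  · rw [Nat.choose_succ_succ, Nat.add_sub_add_right]
    rcases lt_or_ge k (n / 2) with hk | hk
    · obtain ⟨j, hj⟩ := Nat.exists_eq_add_of_lt hk
      have h1 : n / 2 - k = j + 1 := by omega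
      have h2 : n / 2 - (k + 1) = j := by omega
      rw [h1, h2]
      push_cast
      ring
    · rw [Nat.choose_eq_zero_of_lt (Nat.lt_succ_of_le hk)]
      push_cast
      ring
  · simp

theorem tsum_Cterm_of_nonneg {τ a b t : ℝ} {k : ℕ} (h : 0 ≤ t - k * τ) :
    ∑' m : ℕ, Cterm τ a b t k m = expGenFun (cosCoeff a b k) (t - k * τ) := by
  unfold expGenFun
  have hinj : Function.Injective fun m : ℕ => 2 * m := fun x y hxy => by
    simpa using hxy
  rw [← hinj.tsum_eq (f := fun n : ℕ =>
    cosCoeff a b k n * (t - k * τ) ^ n / (n.factorial : ℝ))]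
  · refine tsum_congr fun m => ?_
    unfold Cterm cosCoeff
    rw [max_eq_left h, if_pos (even_two_mul m), Nat.mul_div_cancel_left m two_pos]
    split_ifs with hk
    · rfl
    · rw [Nat.choose_eq_zero_of_lt (not_le.mp hk)]
      simp
  · intro n hn
    by_contra hodd
    refine hn ?_
    have : ¬ Even n := fun ⟨m, hm⟩ => hodd ⟨m, (two_mul m).trans hm.symm⟩
    simp [cosCoeff, this]

theorem tsum_Cterm_of_nonpos {τ a b t : ℝ} {k : ℕ} (hk : k ≠ 0) (h : t - k * τ ≤ 0) :
    ∑' m : ℕ, Cterm τ a b t k m = 0 := by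
  rw [← tsum_zero (β := ℕ)]
  refine tsum_congr fun m => ?_
  unfold Cterm
  split_ifs with hkm
  · rw [max_eq_right h, zero_pow (by omega)]
    simp
  · rfl

theorem Cdel_eq_sum {τ : ℝ} (a b : ℝ) (hτ : 0 < τ) (n : ℕ) {t : ℝ}
    (ht : t ∈ Set.Ioo ((n : ℝ) * τ) (((n : ℝ) + 1) * τ)) :
    Cdel τ a b t = ∑ k ∈ Finset.range (n + 1), expGenFun (cosCoeff a b k) (t - k * τ) := by
  have h0 : 0 ≤ t := le_trans (by positivity) ht.1.le
  rw [Cdel, if_neg (not_lt.mpr h0), tsum_eq_sum (s := Finset.range (n + 1))]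
  · refine Finset.sum_congr rfl fun k hk => tsum_Cterm_of_nonneg ?_
    have hk' : (k : ℝ) ≤ n := by exact_mod_cast Nat.lt_succ_iff.mp (Finset.mem_range.mp hk)
    nlinarith [ht.1]
  · intro k hk
    have hk' : n + 1 ≤ k := by simpa using hk
    have hk'' : (n : ℝ) + 1 ≤ k := by exact_mod_cast hk'
    exact tsum_Cterm_of_nonpos (by omega) (by nlinarith [ht.2])

theorem expGenFun_cosCoeff_zero_add_two (a b x : ℝ) :
    expGenFun (fun n => cosCoeff a b 0 (n + 2)) x = a * expGenFun (cosCoeff a b 0) x := by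
  unfold expGenFun
  rw [← tsum_mul_left]
  refine tsum_congr fun n => ?_
  simp only [cosCoeff_zero_add_two]
  ring

theorem expGenFun_cosCoeff_succ_add_two (a b : ℝ) (k : ℕ) (x : ℝ) :
    expGenFun (fun n => cosCoeff a b (k + 1) (n + 2)) x =
      a * expGenFun (cosCoeff a b (k + 1)) x + b * expGenFun (cosCoeff a b k) x := by
  unfold expGenFun
  rw [← tsum_mul_left, ← tsum_mul_left, ← Summable.tsum_add
    ((summable_expGenFun (abs_cosCoeff_le a b (k + 1)) x).mul_left a)
    ((summable_expGenFun (abs_cosCoeff_le a b k) x).mul_left b)]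
  refine tsum_congr fun n => ?_
  simp only [cosCoeff_succ_add_two]
  ring

theorem Cdel_sub_eq_sum {τ : ℝ} (a b : ℝ) (hτ : 0 < τ) (n : ℕ) {t : ℝ}
    (ht : t ∈ Set.Ioo ((n : ℝ) * τ) (((n : ℝ) + 1) * τ)) :
    Cdel τ a b (t - τ) =
      ∑ k ∈ Finset.range n, expGenFun (cosCoeff a b k) (t - ((k + 1 : ℕ) : ℝ) * τ) := by
  obtain ⟨h1, h2⟩ := ht
  cases n with
  | zero =>
    have : t - τ < 0 := by
      simp only [Nat.cast_zero, zero_add, one_mul] at h2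
      linarith
    simp [Cdel, this]
  | succ n =>
    push_cast at h1 h2
    rw [Cdel_eq_sum a b hτ n ⟨by linarith, by linarith⟩]
    refine Finset.sum_congr rfl fun k _ => ?_
    congr 1
    push_cast
    ring

theorem hasDerivAt_sum_expGenFun_sub {d : ℕ → ℕ → ℝ} {M K : ℝ}
    (hd : ∀ k n, |d k n| ≤ M * K ^ n) (τ : ℝ) (N : ℕ) (t : ℝ) :
    HasDerivAt (fun s => ∑ k ∈ Finset.range N, expGenFun (d k) (s - k * τ))
      (∑ k ∈ Finset.range N, expGenFun (fun n => d k (n + 1)) (t - k * τ)) t :=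
  HasDerivAt.fun_sum fun k _ => (hasDerivAt_expGenFun (hd k) (t - k * τ)).comp_sub_const t _

/-- for every integer `n ≥ 0` and `t ∈ (nτ, (n+1)τ)`, the second derivative
of `C_τ^{a,b}` exists at `t` and satisfies the homogeneous delay differential equation
`(C_τ^{a,b})''(t) = a·C_τ^{a,b}(t) + b·C_τ^{a,b}(t-τ)` (with the extension-by-zero
convention for negative arguments built into `Cdel`). -/
theorem Cdel_delay_ODE (τ a b : ℝ) (hτ : 0 < τ) (n : ℕ) (t : ℝ)
    (ht : t ∈ Set.Ioo ((n : ℝ) * τ) (((n : ℝ) + 1) * τ)) :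
    HasDerivAt (Cdel τ a b) (deriv (Cdel τ a b) t) t ∧
    HasDerivAt (deriv (Cdel τ a b)) (a * Cdel τ a b t + b * Cdel τ a b (t - τ)) t := by
  have hd := abs_cosCoeff_le a b
  have hd' : ∀ k n, |cosCoeff a b k (n + 1)| ≤
      2 * (1 + |a| + |b|) * (2 * (1 + |a| + |b|)) ^ n := fun k n => by
    simpa only [one_mul, pow_succ'] using hd k (n + 1)
  have hderiv : ∀ s ∈ Set.Ioo ((n : ℝ) * τ) (((n : ℝ) + 1) * τ),
      HasDerivAt (Cdel τ a b) (∑ k ∈ Finset.range (n + 1),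
        expGenFun (fun j => cosCoeff a b k (j + 1)) (s - k * τ)) s := fun s hs =>
    (hasDerivAt_sum_expGenFun_sub hd τ (n + 1) s).congr_of_eventuallyEq <| by
      filter_upwards [isOpen_Ioo.mem_nhds hs] with r hr using Cdel_eq_sum a b hτ n hr
  refine ⟨(hderiv t ht).differentiableAt.hasDerivAt, ?_⟩
  have hsecond : HasDerivAt (deriv (Cdel τ a b)) (∑ k ∈ Finset.range (n + 1),
      expGenFun (fun j => cosCoeff a b k (j + 2)) (t - k * τ)) t :=
    (hasDerivAt_sum_expGenFun_sub hd' τ (n + 1) t).congr_of_eventuallyEq <| by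
      filter_upwards [isOpen_Ioo.mem_nhds ht] with r hr using (hderiv r hr).deriv
  refine hsecond.congr_deriv ?_
  rw [Cdel_sub_eq_sum a b hτ n ht, Cdel_eq_sum a b hτ n ht, Finset.sum_range_succ',
    Finset.sum_range_succ', expGenFun_cosCoeff_zero_add_two]
  simp only [expGenFun_cosCoeff_succ_add_two, Finset.sum_add_distrib, ← Finset.mul_sum]
  ring
end

section
/- (Particular solution with zero history.) Let f ∈ C([0,T],ℝ). Define y_p : [-τ,T] → ℝ by y_p(t) = 0 for t ∈ [-τ,0] and y_p(t) = ∫_{0}^{t} S_τ^{a,b}(t-s)·f(s) ds for t ∈ [0,T]. Then y_p is a stepwise solution of ÿ(t) = a·y(t) + b·y(t-τ) + f(t) with zero history (φ ≡ 0). -/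
/-- Stepwise (piecewise-in-time) classical solution of the scalar delay equation
`ÿ(t) = a·y(t) + b·y(t-τ) + f(t)` on `[0, Nτ]` with history `φ` on `[-τ, 0]`:
`y` and its first derivative are continuous on `[-τ, Nτ]`; on each open step interval
`((k-1)τ, kτ)` the second derivative exists, is continuous, satisfies the equation
pointwise, and has finite one-sided limits at the endpoints; and `y = φ`, `y' = φ'`
on `[-τ, 0]`. -/
def StepwiseSolution (τ : ℝ) (N : ℕ) (a b : ℝ) (f φ y : ℝ → ℝ) : Prop :=
  ContinuousOn y (Set.Icc (-τ) ((N : ℝ) * τ)) ∧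
  DifferentiableOn ℝ y (Set.Icc (-τ) ((N : ℝ) * τ)) ∧
  ContinuousOn (derivWithin y (Set.Icc (-τ) ((N : ℝ) * τ))) (Set.Icc (-τ) ((N : ℝ) * τ)) ∧
  (∀ k : ℕ, 1 ≤ k → k ≤ N →
    (∀ t ∈ Set.Ioo (((k : ℝ) - 1) * τ) ((k : ℝ) * τ),
      HasDerivAt y (deriv y t) t ∧
      HasDerivAt (deriv y) (a * y t + b * y (t - τ) + f t) t) ∧
    ContinuousOn (deriv (deriv y)) (Set.Ioo (((k : ℝ) - 1) * τ) ((k : ℝ) * τ)) ∧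
    (∃ l : ℝ, Filter.Tendsto (deriv (deriv y))
      (nhdsWithin (((k : ℝ) - 1) * τ) (Set.Ioo (((k : ℝ) - 1) * τ) ((k : ℝ) * τ))) (nhds l)) ∧
    (∃ l : ℝ, Filter.Tendsto (deriv (deriv y))
      (nhdsWithin ((k : ℝ) * τ) (Set.Ioo (((k : ℝ) - 1) * τ) ((k : ℝ) * τ))) (nhds l))) ∧
  (∀ t ∈ Set.Icc (-τ) (0 : ℝ), y t = φ t ∧
    derivWithin y (Set.Icc (-τ) ((N : ℝ) * τ)) t = derivWithin φ (Set.Icc (-τ) (0 : ℝ)) t)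

open Set Filter Topology

/-- The truncated power `t ↦ (t)_+ ^ (n + 2) / (n + 2)!` is continuously differentiable. -/
lemma hasDerivAt_max_zero_pow_div_factorial (n : ℕ) (t : ℝ) :
    HasDerivAt (fun t : ℝ => (max t 0) ^ (n + 2) / (Nat.factorial (n + 2) : ℝ))
      ((max t 0) ^ (n + 1) / (Nat.factorial (n + 1) : ℝ)) t := by
  have hpow : HasDerivAt (fun t : ℝ => t ^ (n + 2) / (Nat.factorial (n + 2) : ℝ))
      (t ^ (n + 1) / (Nat.factorial (n + 1) : ℝ)) t := by
    convert! (hasDerivAt_pow (n + 2) t).div_const (Nat.factorial (n + 2) : ℝ) using 1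
    have h : (Nat.factorial (n + 1) : ℝ) ≠ 0 := by positivity
    rw [Nat.factorial_succ (n + 1)]
    push_cast
    field_simp
    norm_num [add_assoc]
  have right : 0 ≤ t → HasDerivWithinAt
      (fun t : ℝ => (max t 0) ^ (n + 2) / (Nat.factorial (n + 2) : ℝ))
      ((max t 0) ^ (n + 1) / (Nat.factorial (n + 1) : ℝ)) (Ici 0) t := fun ht => by
    rw [max_eq_left ht]
    exact hpow.hasDerivWithinAt.congr (fun x hx => by rw [max_eq_left (mem_Ici.1 hx)])
      (by rw [max_eq_left ht])
  have left : t ≤ 0 → HasDerivWithinAt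
      (fun t : ℝ => (max t 0) ^ (n + 2) / (Nat.factorial (n + 2) : ℝ))
      ((max t 0) ^ (n + 1) / (Nat.factorial (n + 1) : ℝ)) (Iic 0) t := fun ht => by
    rw [max_eq_right ht]
    simp only [ne_eq, Nat.add_eq_zero_iff, one_ne_zero, and_false, not_false_eq_true, zero_pow,
      zero_div]
    exact (hasDerivWithinAt_const t (Iic 0) (0 : ℝ)).congr
      (fun x hx => by simp [max_eq_right (mem_Iic.1 hx)]) (by simp [max_eq_right ht])
  rcases lt_trichotomy t 0 with ht | rfl | ht
  · exact (left ht.le).hasDerivAt (Iic_mem_nhds ht)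
  · simpa using! (left le_rfl).union (right le_rfl)
  · exact (right ht.le).hasDerivAt (Ici_mem_nhds ht)

/-- The `m`-th iterate of `g ↦ a • g + b • g (· - τ)` applied to the truncated power
`t ↦ (t)_+ ^ j / j!`. -/
noncomputable def delayedPow (τ a b : ℝ) (j : ℕ) : ℕ → ℝ → ℝ
  | 0, t => (max t 0) ^ j / (Nat.factorial j : ℝ)
  | m + 1, t => a * delayedPow τ a b j m t + b * delayedPow τ a b j m (t - τ)

lemma delayedPow_eq_sum (τ a b : ℝ) (j m : ℕ) (t : ℝ) :
    delayedPow τ a b j m t = ∑ p ∈ Finset.HasAntidiagonal.antidiagonal m, (m.choose p.1 : ℝ) *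
      (a ^ p.2 * b ^ p.1 * ((max (t - (p.1 : ℝ) * τ) 0) ^ j / (Nat.factorial j : ℝ))) := by
  induction m generalizing t with
  | zero => simp [delayedPow]
  | succ m ih =>
    rw [Finset.sum_antidiagonal_choose_succ_mul (fun k l => a ^ l * b ^ k *
      ((max (t - (k : ℝ) * τ) 0) ^ j / (Nat.factorial j : ℝ))), delayedPow, ih, ih,
      Finset.mul_sum, Finset.mul_sum]
    congr 1
    · refine Finset.sum_congr rfl fun p _ => ?_
      ring
    · refine Finset.sum_congr rfl fun p hp => ?_
      rw [← Nat.choose_symm_of_eq_add (Finset.HasAntidiagonal.mem_antidiagonal.1 hp).symm,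
        show t - τ - (p.1 : ℝ) * τ = t - ((p.1 + 1 : ℕ) : ℝ) * τ by push_cast; ring]
      ring

lemma delayedPow_of_nonpos {τ t : ℝ} (hτ : 0 ≤ τ) (a b : ℝ) {j : ℕ} (hj : j ≠ 0) (m : ℕ)
    (ht : t ≤ 0) : delayedPow τ a b j m t = 0 := by
  induction m generalizing t with
  | zero => simp [delayedPow, max_eq_right ht, hj]
  | succ m ih => simp [delayedPow, ih ht, ih (show t - τ ≤ 0 by linarith)]

lemma abs_delayedPow_le {τ t R : ℝ} (hτ : 0 ≤ τ) (a b : ℝ) (j m : ℕ) (hR : 0 ≤ R) (ht : t ≤ R) :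
    |delayedPow τ a b j m t| ≤ (|a| + |b|) ^ m * R ^ j / (Nat.factorial j : ℝ) := by
  induction m generalizing t with
  | zero =>
    rw [delayedPow, abs_of_nonneg (by positivity), pow_zero, one_mul]
    gcongr
    exact max_le ht hR
  | succ m ih =>
    calc |delayedPow τ a b j (m + 1) t|
        ≤ |a| * |delayedPow τ a b j m t| + |b| * |delayedPow τ a b j m (t - τ)| := by
          rw [delayedPow, ← abs_mul, ← abs_mul]
          exact abs_add_le _ _
      _ ≤ |a| * ((|a| + |b|) ^ m * R ^ j / (Nat.factorial j : ℝ)) +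
          |b| * ((|a| + |b|) ^ m * R ^ j / (Nat.factorial j : ℝ)) := by
          gcongr
          · exact ih ht
          · exact ih (by linarith)
      _ = (|a| + |b|) ^ (m + 1) * R ^ j / (Nat.factorial j : ℝ) := by ring

lemma hasDerivAt_delayedPow (τ a b : ℝ) (n m : ℕ) (t : ℝ) :
    HasDerivAt (delayedPow τ a b (n + 2) m) (delayedPow τ a b (n + 1) m t) t := by
  induction m generalizing t with
  | zero => exact hasDerivAt_max_zero_pow_div_factorial n t
  | succ m ih =>
    exact ((ih t).const_mul a).add (((ih (t - τ)).comp_sub_const t τ).const_mul b)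

lemma summable_pow_mul_pow_div_factorial {A R : ℝ} (hA : 0 ≤ A) (hR : 0 ≤ R) (c : ℕ) :
    Summable fun m : ℕ => A ^ m * R ^ (2 * m + c) / (Nat.factorial (2 * m + c) : ℝ) := by
  have h := (Real.summable_pow_div_factorial ((A + 1) * R)).comp_injective
    (i := fun m : ℕ => 2 * m + c) (fun x y hxy => by simpa using hxy)
  refine Summable.of_nonneg_of_le (fun m => by positivity) (fun m => ?_) h
  simp only [Function.comp_apply, mul_pow]
  gcongr
  calc A ^ m ≤ (A + 1) ^ m := by gcongr; linarith
    _ ≤ (A + 1) ^ (2 * m + c) := pow_le_pow_right₀ (by linarith) (by omega)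

lemma summable_delayedPow {τ : ℝ} (hτ : 0 ≤ τ) (a b t : ℝ) (c : ℕ) :
    Summable fun m : ℕ => delayedPow τ a b (2 * m + c) m t :=
  .of_norm_bounded
    (summable_pow_mul_pow_div_factorial (A := |a| + |b|) (by positivity) (abs_nonneg t) c)
    fun m => abs_delayedPow_le hτ a b _ m (abs_nonneg t) (le_abs_self t)

lemma hasSum_Sterm (τ a b t : ℝ) (m : ℕ) :
    HasSum (fun k => Sterm τ a b t k m) (delayedPow τ a b (2 * m + 1) m t) := by
  rw [delayedPow_eq_sum, Finset.Nat.sum_antidiagonal_eq_sum_range_succ (fun k l => (m.choose k : ℝ) *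
      (a ^ l * b ^ k * ((max (t - (k : ℝ) * τ) 0) ^ (2 * m + 1) /
        (Nat.factorial (2 * m + 1) : ℝ))))]
  have h : ∀ k ∉ Finset.range (m + 1), Sterm τ a b t k m = 0 := fun k hk =>
    if_neg (by simpa [Nat.lt_succ_iff] using hk)
  convert hasSum_sum_of_ne_finset_zero (L := .unconditional ℕ) h using 1
  refine Finset.sum_congr rfl fun k hk => ?_
  rw [Sterm, if_pos (Nat.lt_succ_iff.1 (Finset.mem_range.1 hk))]
  ring

lemma abs_Sterm (τ a b t : ℝ) (k m : ℕ) : |Sterm τ a b t k m| = Sterm τ |a| |b| t k m := by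
  unfold Sterm
  split_ifs
  · have h : 0 ≤ max (t - (k : ℝ) * τ) 0 := le_max_right _ _
    simp only [abs_div, abs_mul, abs_pow, Nat.abs_cast, abs_of_nonneg h]
  · exact abs_zero

lemma summable_uncurry_Sterm {τ : ℝ} (hτ : 0 ≤ τ) (a b t : ℝ) :
    Summable (Function.uncurry fun m k => Sterm τ a b t k m) := by
  refine Summable.of_norm ((summable_prod_of_nonneg fun _ => norm_nonneg _).2 ⟨fun m => ?_, ?_⟩)
  · simpa only [Function.uncurry, Real.norm_eq_abs, abs_Sterm] using
      (hasSum_Sterm τ |a| |b| t m).summable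
  · simpa only [Function.uncurry, Real.norm_eq_abs, abs_Sterm, (hasSum_Sterm _ _ _ _ _).tsum_eq]
      using summable_delayedPow hτ |a| |b| t 1

lemma Sdel_eq_tsum {τ : ℝ} (hτ : 0 ≤ τ) (a b t : ℝ) :
    Sdel τ a b t = ∑' m : ℕ, delayedPow τ a b (2 * m + 1) m t := by
  unfold Sdel
  split_ifs with ht
  · simp [delayedPow_of_nonpos hτ a b (Nat.succ_ne_zero _) _ ht.le]
  · rw [(summable_uncurry_Sterm hτ a b t).tsum_comm]
    exact tsum_congr fun m => (hasSum_Sterm τ a b t m).tsum_eq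

lemma Sdel_of_nonpos {τ t : ℝ} (hτ : 0 ≤ τ) (a b : ℝ) (ht : t ≤ 0) : Sdel τ a b t = 0 := by
  simp [Sdel_eq_tsum hτ, delayedPow_of_nonpos hτ a b (Nat.succ_ne_zero _) _ ht]

/-- The tails (`m ≥ 1`) of the series for the delayed sine (`i = 2`) and of its derivatives
(`i = 1, 0`). -/
noncomputable def delayedTail (τ a b : ℝ) (i : ℕ) (t : ℝ) : ℝ :=
  ∑' m : ℕ, delayedPow τ a b (2 * m + 1 + i) (m + 1) t

lemma delayedTail_of_nonpos {τ t : ℝ} (hτ : 0 ≤ τ) (a b : ℝ) (i : ℕ) (ht : t ≤ 0) :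
    delayedTail τ a b i t = 0 := by
  have h (m : ℕ) : delayedPow τ a b (2 * m + 1 + i) (m + 1) t = 0 :=
    delayedPow_of_nonpos hτ a b (by omega) _ ht
  simp [delayedTail, h]

lemma hasDerivAt_delayedTail {τ : ℝ} (hτ : 0 ≤ τ) (a b : ℝ) (i : ℕ) (t : ℝ) :
    HasDerivAt (delayedTail τ a b (i + 1)) (delayedTail τ a b i t) t := by
  have hR : (0 : ℝ) ≤ |t| + 1 := by positivity
  have hu := (summable_pow_mul_pow_div_factorial (A := |a| + |b|) (by positivity) hR
    (1 + i)).mul_left (|a| + |b|)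
  refine hasDerivAt_tsum_of_isPreconnected (t := Iio (|t| + 1)) (y₀ := 0) hu isOpen_Iio
    isPreconnected_Iio (fun m y _ => ?_) (fun m y hy => ?_) (mem_Iio.2 (by positivity)) ?_
    (mem_Iio.2 (by linarith [le_abs_self t]))
  · have := hasDerivAt_delayedPow τ a b (2 * m + i) (m + 1) y
    rwa [show 2 * m + i + 2 = 2 * m + 1 + (i + 1) by ring,
      show 2 * m + i + 1 = 2 * m + 1 + i by ring] at this
  · refine (abs_delayedPow_le hτ a b _ _ hR (le_of_lt hy)).trans_eq ?_
    rw [add_assoc (2 * m)]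
    ring
  · have h (m : ℕ) : delayedPow τ a b (2 * m + 1 + (i + 1)) (m + 1) 0 = 0 :=
      delayedPow_of_nonpos hτ a b (by omega) _ le_rfl
    simpa only [h] using summable_zero

lemma Sdel_eq_max_add {τ : ℝ} (hτ : 0 ≤ τ) (a b t : ℝ) :
    Sdel τ a b t = max t 0 + delayedTail τ a b 2 t := by
  rw [Sdel_eq_tsum hτ, (summable_delayedPow hτ a b t 1).tsum_eq_zero_add]
  simp only [delayedPow, delayedTail, mul_zero, zero_add, pow_one, Nat.factorial_one, Nat.cast_one,
    div_one]
  congr 2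

lemma delayedTail_zero {τ : ℝ} (hτ : 0 ≤ τ) (a b t : ℝ) :
    delayedTail τ a b 0 t = a * Sdel τ a b t + b * Sdel τ a b (t - τ) := by
  have h (s : ℝ) := summable_delayedPow hτ a b s 1
  rw [Sdel_eq_tsum hτ, Sdel_eq_tsum hτ, ← tsum_mul_left, ← tsum_mul_left,
    ← ((h t).mul_left a).tsum_add ((h (t - τ)).mul_left b)]
  rfl

lemma continuous_Sdel {τ : ℝ} (hτ : 0 ≤ τ) (a b : ℝ) : Continuous (Sdel τ a b) := by
  have h : Continuous (delayedTail τ a b 2) :=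
    continuous_iff_continuousAt.2 fun t => (hasDerivAt_delayedTail hτ a b 1 t).continuousAt
  rw [show Sdel τ a b = _ from funext (Sdel_eq_max_add hτ a b)]
  fun_prop

/-- Differentiation of a Volterra convolution `∫₀ᵗ K (t - s) f(s) ds` with `C¹` kernel. -/
lemma hasDerivAt_integral_sub_mul {K k f : ℝ → ℝ} (hK : ∀ t, HasDerivAt K (k t) t)
    (hk : Continuous k) (hf : Continuous f) (t : ℝ) :
    HasDerivAt (fun t => ∫ s in (0 : ℝ)..t, K (t - s) * f s)
      (K 0 * f t + ∫ s in (0 : ℝ)..t, k (t - s) * f s) t := by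
  have hKc : Continuous K := continuous_iff_continuousAt.2 fun t => (hK t).continuousAt
  set G : ℝ → ℝ → ℝ := fun x y => ∫ s in (0 : ℝ)..y, K (x - s) * f s
  have hx (x y : ℝ) : HasDerivAt (fun x => G x y) (∫ s in (0 : ℝ)..y, k (x - s) * f s) x := by
    obtain ⟨M, hM⟩ := ((isCompact_closedBall x 1).prod (isCompact_uIcc (a := 0) (b := y)))
      |>.exists_bound_of_continuousOn (f := fun p : ℝ × ℝ => k (p.1 - p.2) * f p.2)
        (by fun_prop)
    refine (intervalIntegral.hasDerivAt_integral_of_dominated_loc_of_deriv_le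
      (F := fun x s => K (x - s) * f s) (F' := fun x s => k (x - s) * f s) (bound := fun _ => M)
      (Metric.closedBall_mem_nhds x one_pos) (.of_forall fun x => ?_) ?_ ?_
      (.of_forall fun s hs z hz => hM (z, s) ⟨hz, uIoc_subset_uIcc hs⟩)
      (by simp) (.of_forall fun s _ z _ => ?_)).2
    · exact Continuous.aestronglyMeasurable (by fun_prop)
    · exact Continuous.intervalIntegrable (by fun_prop) _ _
    · exact Continuous.aestronglyMeasurable (by fun_prop)
    · exact ((hK (z - s)).comp_sub_const z s).mul_const (f s)
  have hy (x y : ℝ) : HasDerivAt (G x) (K (x - y) * f y) y :=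
    (show Continuous fun s => K (x - s) * f s by fun_prop).integral_hasStrictDerivAt 0 y
      |>.hasDerivAt
  have c₁ : Continuous fun p : ℝ × ℝ => ∫ s in (0 : ℝ)..p.2, k (p.1 - s) * f s := by
    fun_prop
  have c₂ : Continuous fun p : ℝ × ℝ => K (p.1 - p.2) * f p.2 := by fun_prop
  have key := hasStrictFDerivAt_uncurry_coprod (𝕜 := ℝ) (u := (t, t)) (f := G)
    (f₁ := fun x y => ContinuousLinearMap.toSpanSingleton ℝ (∫ s in (0 : ℝ)..y, k (x - s) * f s))
    (f₂ := fun x y => ContinuousLinearMap.toSpanSingleton ℝ (K (x - y) * f y))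
    (.of_forall fun v => (hx v.1 v.2).hasFDerivAt) (.of_forall fun v => (hy v.1 v.2).hasFDerivAt)
    ((ContinuousLinearMap.toSpanSingletonCLE.continuous.comp c₁).continuousAt)
    ((ContinuousLinearMap.toSpanSingletonCLE.continuous.comp c₂).continuousAt)
  have := HasFDerivAt.comp_hasDerivAt (f := fun x : ℝ => (x, x)) t key.hasFDerivAt
    ((hasDerivAt_id t).prodMk (hasDerivAt_id t))
  convert! this using 1
  simp [Function.HasUncurry.uncurry, add_comm]

lemma exists_delayed_convolution {τ : ℝ} (hτ : 0 < τ) (a b : ℝ) {f : ℝ → ℝ} (hf : Continuous f) :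
    ∃ w v : ℝ → ℝ, Continuous v ∧ (∀ t, HasDerivAt w (v t) t) ∧
      (∀ t ≤ 0, w t = 0 ∧ v t = 0) ∧
      (∀ t, 0 ≤ t → w t = ∫ s in (0 : ℝ)..t, Sdel τ a b (t - s) * f s) ∧
      ∀ t, 0 < t → HasDerivAt v (a * w t + b * w (t - τ) + f t) t := by
  set S := Sdel τ a b
  have hSc : Continuous S := continuous_Sdel hτ.le a b
  set Z : ℝ → ℝ := fun t => ∫ s in (0 : ℝ)..t, (1 + delayedTail τ a b 1 (t - s)) * f s
  have hC (t : ℝ) : HasDerivAt (fun t => 1 + delayedTail τ a b 1 t)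
      (a * S t + b * S (t - τ)) t := by
    rw [← delayedTail_zero hτ.le]
    exact (hasDerivAt_delayedTail hτ.le a b 0 t).const_add 1
  have hCc : Continuous fun t => 1 + delayedTail τ a b 1 t :=
    continuous_iff_continuousAt.2 fun t => (hC t).continuousAt
  have hY (t : ℝ) : HasDerivAt
      (fun t => ∫ s in (0 : ℝ)..t, (t - s + delayedTail τ a b 2 (t - s)) * f s) (Z t) t := by
    simpa [delayedTail_of_nonpos hτ.le a b 2 le_rfl] using
      hasDerivAt_integral_sub_mul (K := fun t => t + delayedTail τ a b 2 t)
        (fun t => (hasDerivAt_id t).add (hasDerivAt_delayedTail hτ.le a b 1 t)) hCc hf t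
  have hZ (t : ℝ) : HasDerivAt Z
      (f t + ∫ s in (0 : ℝ)..t, (a * S (t - s) + b * S (t - s - τ)) * f s) t := by
    simpa [delayedTail_of_nonpos hτ.le a b 1 le_rfl] using
      hasDerivAt_integral_sub_mul hC (by fun_prop) hf t
  have hZc : Continuous Z := continuous_iff_continuousAt.2 fun t => (hZ t).continuousAt
  have hZ0 : Z 0 = 0 := intervalIntegral.integral_same
  have hvc : Continuous fun t => Z (max t 0) := by fun_prop
  have hw0 (t : ℝ) (ht : t ≤ 0) : ∫ s in (0 : ℝ)..t, Z (max s 0) = 0 := by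
    rw [intervalIntegral.integral_symm, intervalIntegral.integral_congr (g := fun _ => 0)]
    · simp
    · intro s hs
      rw [uIcc_of_le ht] at hs
      simp [max_eq_right hs.2, hZ0]
  have hw (t : ℝ) (ht : 0 ≤ t) :
      ∫ s in (0 : ℝ)..t, Z (max s 0) = ∫ s in (0 : ℝ)..t, S (t - s) * f s := by
    calc ∫ s in (0 : ℝ)..t, Z (max s 0) = ∫ s in (0 : ℝ)..t, Z s :=
          intervalIntegral.integral_congr fun s hs => by
            rw [uIcc_of_le ht] at hs
            simp [max_eq_left hs.1]
      _ = ∫ s in (0 : ℝ)..t, (t - s + delayedTail τ a b 2 (t - s)) * f s := by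
          rw [intervalIntegral.integral_eq_sub_of_hasDerivAt (fun s _ => hY s)
            (hZc.intervalIntegrable _ _)]
          simp
      _ = ∫ s in (0 : ℝ)..t, S (t - s) * f s :=
          intervalIntegral.integral_congr fun s hs => by
            rw [uIcc_of_le ht] at hs
            simp [S, Sdel_eq_max_add hτ.le, hs.2]
  refine ⟨fun t => ∫ s in (0 : ℝ)..t, Z (max s 0), fun t => Z (max t 0), hvc,
    fun t => (hvc.integral_hasStrictDerivAt 0 t).hasDerivAt,
    fun t ht => ⟨hw0 t ht, by simp only [max_eq_right ht, hZ0]⟩, hw, fun t ht => ?_⟩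
  have hdelay : ∫ s in (0 : ℝ)..t, S (t - s - τ) * f s = ∫ s in (0 : ℝ)..(t - τ), Z (max s 0) := by
    have hvanish {c : ℝ} (hc : t - τ ≤ c) (hct : c ≤ t) :
        ∫ s in c..t, S (t - s - τ) * f s = 0 := by
      rw [intervalIntegral.integral_congr (g := fun _ => 0), intervalIntegral.integral_zero]
      intro s hs
      rw [uIcc_of_le hct] at hs
      have : S (t - s - τ) = 0 := Sdel_of_nonpos hτ.le a b (by linarith [hs.1])
      simp [this]
    rcases le_total (t - τ) 0 with h | h
    · rw [hw0 _ h, hvanish h ht.le]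
    · rw [hw _ h, ← intervalIntegral.integral_add_adjacent_intervals (b := t - τ)
        (Continuous.intervalIntegrable (by fun_prop) _ _)
        (Continuous.intervalIntegrable (by fun_prop) _ _), hvanish le_rfl (by linarith), add_zero]
      simp only [sub_right_comm]
  have hval : f t + ∫ s in (0 : ℝ)..t, (a * S (t - s) + b * S (t - s - τ)) * f s =
      a * (∫ s in (0 : ℝ)..t, Z (max s 0)) + b * (∫ s in (0 : ℝ)..(t - τ), Z (max s 0)) + f t := by
    rw [hw t ht.le, ← hdelay, ← intervalIntegral.integral_const_mul,
      ← intervalIntegral.integral_const_mul, ← intervalIntegral.integral_add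
        (Continuous.intervalIntegrable (by fun_prop) _ _)
        (Continuous.intervalIntegrable (by fun_prop) _ _), add_comm]
    congr 1
    refine intervalIntegral.integral_congr fun s _ => ?_
    ring
  dsimp only
  rw [← hval]
  refine (hZ t).congr_of_eventuallyEq ?_
  filter_upwards [Ioi_mem_nhds ht] with s hs
  rw [max_eq_left (le_of_lt hs)]

/-- particular solution with zero history: if `f ∈ C([0,T])` (`T = Nτ`)
and `y_p` vanishes on `[-τ,0]` and equals `∫_0^t S_τ^{a,b}(t-s)·f(s) ds` on `[0,T]`, then
`y_p` is a stepwise solution of `ÿ = a·y(t) + b·y(t-τ) + f(t)` with zero history. -/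
theorem particular_solution_zero_history (τ : ℝ) (hτ : 0 < τ) (N : ℕ) (a b : ℝ)
    (f : ℝ → ℝ) (hf : ContinuousOn f (Set.Icc (0 : ℝ) ((N : ℝ) * τ)))
    (yp : ℝ → ℝ)
    (hist : ∀ t ∈ Set.Icc (-τ) (0 : ℝ), yp t = 0)
    (formula : ∀ t ∈ Set.Icc (0 : ℝ) ((N : ℝ) * τ),
      yp t = ∫ s in (0 : ℝ)..t, Sdel τ a b (t - s) * f s) :
    StepwiseSolution τ N a b f (fun _ => 0) yp := by
  set T : ℝ := (N : ℝ) * τ with hTdef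
  have hT : 0 ≤ T := by positivity
  set g : ℝ → ℝ := IccExtend hT ((Icc 0 T).domRestrict f)
  have hg : Continuous g := hf.domRestrict.Icc_extend'
  have hgf : ∀ t ∈ Icc 0 T, g t = f t := fun t ht => IccExtend_of_mem hT _ ht
  obtain ⟨w, v, hv, hwv, hneg, hw, hvd⟩ := exists_delayed_convolution hτ a b hg
  have hwc : Continuous w := continuous_iff_continuousAt.2 fun t => (hwv t).continuousAt
  have hyw : EqOn yp w (Icc (-τ) T) := fun t ht => by
    rcases le_total t 0 with h | h
    · rw [hist t ⟨ht.1, h⟩, (hneg t h).1]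
    · rw [formula t ⟨h, ht.2⟩, hw t h]
      refine intervalIntegral.integral_congr fun s hs => ?_
      rw [uIcc_of_le h] at hs
      simp only [hgf s ⟨hs.1, hs.2.trans ht.2⟩]
  have hder : ∀ t ∈ Icc (-τ) T, HasDerivWithinAt yp (v t) (Icc (-τ) T) t := fun t ht =>
    (hwv t).hasDerivWithinAt.congr hyw (hyw ht)
  have hdw : EqOn (derivWithin yp (Icc (-τ) T)) v (Icc (-τ) T) := fun t ht =>
    (hder t ht).derivWithin (uniqueDiffOn_Icc (by linarith) t ht)
  refine ⟨hwc.continuousOn.congr hyw, fun t ht => (hder t ht).differentiableWithinAt,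
    hv.continuousOn.congr hdw, fun k hk hkN => ?_, fun t ht => ⟨hist t ht, ?_⟩⟩
  · have hl : 0 ≤ ((k : ℝ) - 1) * τ :=
      mul_nonneg (sub_nonneg.2 (by exact_mod_cast hk)) hτ.le
    have hr : (k : ℝ) * τ ≤ T := by rw [hTdef]; gcongr
    set J := Ioo (((k : ℝ) - 1) * τ) ((k : ℝ) * τ)
    have hJ : ∀ t ∈ J, 0 < t ∧ t < T := fun t ht => ⟨hl.trans_lt ht.1, ht.2.trans_le hr⟩
    have hd : ∀ t ∈ J, HasDerivAt yp (v t) t := fun t ht =>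
      (hder t ⟨by linarith [(hJ t ht).1], (hJ t ht).2.le⟩).hasDerivAt
        (Icc_mem_nhds (by linarith [(hJ t ht).1]) (hJ t ht).2)
    have hdd : ∀ t ∈ J, HasDerivAt (deriv yp) (a * w t + b * w (t - τ) + g t) t := fun t ht => by
      refine (hvd t (hJ t ht).1).congr_of_eventuallyEq ?_
      filter_upwards [isOpen_Ioo.mem_nhds ht] with s hs
      exact (hd s hs).deriv
    have hrhs : Continuous fun t => a * w t + b * w (t - τ) + g t := by fun_prop
    have heq : EqOn (deriv (deriv yp)) (fun t => a * w t + b * w (t - τ) + g t) J :=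
      fun t ht => (hdd t ht).deriv
    have hlim (c : ℝ) : ∃ l : ℝ, Tendsto (deriv (deriv yp)) (𝓝[J] c) (𝓝 l) :=
      ⟨_, (hrhs.continuousWithinAt (s := J) (x := c)).tendsto.congr'
        (eventually_nhdsWithin_of_forall fun t ht => (heq ht).symm)⟩
    refine ⟨fun t ht => ⟨(hd t ht).differentiableAt.hasDerivAt, ?_⟩,
      hrhs.continuousOn.congr heq, hlim _, hlim _⟩
    have h := hJ t ht
    rw [hyw ⟨by linarith, h.2.le⟩, hyw (x := t - τ) ⟨by linarith, by linarith⟩,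
      ← hgf t ⟨h.1.le, h.2.le⟩]
    exact hdd t ht
  · rw [hdw ⟨ht.1, ht.2.trans hT⟩, (hneg t ht.2).2]
    simp
end

section
/- Let f ∈ C([0,T],ℝ) and define y_p(t) = ∫_{0}^{t} S_τ^{a,b}(t-s)·f(s) ds for t ∈ [0,T]. Then y_p is differentiable on (0,T] with derivative y_p'(t) = ∫_{0}^{t} (d/dξ)S_τ^{a,b}(ξ)|_{ξ=t-s}·f(s) ds, y_p' is continuous on [0,T], and y_p(0) = 0, y_p'(0) = 0. -/
open Set Filter Topology MeasureTheory

theorem hasDerivAt_max_zero_pow {n : ℕ} (hn : 1 ≤ n) (x : ℝ) :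
    HasDerivAt (fun y : ℝ => max y 0 ^ (n + 1)) ((n + 1 : ℝ) * max x 0 ^ n) x := by
  have hn0 : n ≠ 0 := by omega
  rcases lt_trichotomy x 0 with hx | rfl | hx
  · have h : (fun y : ℝ => max y 0 ^ (n + 1)) =ᶠ[𝓝 x] fun _ => 0 := by
      filter_upwards [Iio_mem_nhds hx] with y hy
      simp [max_eq_right (mem_Iio.1 hy).le]
    simpa [max_eq_right hx.le, hn0] using (hasDerivAt_const x (0 : ℝ)).congr_of_eventuallyEq h
  · rw [hasDerivAt_iff_isLittleO]
    simp only [max_self, ne_eq, hn0, not_false_eq_true, zero_pow, mul_zero, smul_zero, sub_zero,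
      Nat.add_eq_zero_iff, one_ne_zero, and_false]
    refine Asymptotics.IsBigO.trans_isLittleO (g := fun y : ℝ => y ^ (n + 1)) ?_ ?_
    · refine Asymptotics.IsBigO.of_bound 1 (Eventually.of_forall fun y => ?_)
      rw [one_mul, norm_pow, norm_pow]
      refine pow_le_pow_left₀ (norm_nonneg _) ?_ _
      rw [Real.norm_eq_abs, Real.norm_eq_abs, abs_of_nonneg (le_max_right y 0)]
      exact max_le (le_abs_self y) (abs_nonneg y)
    · simpa using Asymptotics.isLittleO_pow_pow (𝕜 := ℝ) (m := 1) (n := n + 1) (by omega)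
  · have h : (fun y : ℝ => max y 0 ^ (n + 1)) =ᶠ[𝓝 x] fun y => y ^ (n + 1) := by
      filter_upwards [Ioi_mem_nhds hx] with y hy
      rw [max_eq_left (mem_Ioi.1 hy).le]
    simpa [max_eq_left hx.le] using (hasDerivAt_pow (n + 1) x).congr_of_eventuallyEq h

/-- A term of the series of `Sdel`, with the leading term `max t 0` replaced by `t`, which makes
it continuously differentiable on the whole line. -/
noncomputable def smoothTerm (τ a b t : ℝ) (p : ℕ × ℕ) : ℝ :=
  if p = (0, 0) then t else Sterm τ a b t p.1 p.2

theorem hasDerivAt_smoothTerm (τ a b t : ℝ) (p : ℕ × ℕ) :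
    HasDerivAt (fun x => smoothTerm τ a b x p) (Cterm τ a b t p.1 p.2) t := by
  obtain ⟨k, m⟩ := p
  by_cases h0 : (k, m) = (0, 0)
  · obtain ⟨rfl, rfl⟩ := Prod.mk.inj h0
    simpa [smoothTerm, Cterm] using hasDerivAt_id' t
  simp only [smoothTerm, h0, if_false, Sterm, Cterm]
  by_cases hkm : k ≤ m
  · have hm : 1 ≤ m := by
      by_contra! h
      exact h0 (by ext <;> simp <;> omega)
    simp only [hkm, if_true]
    have hd := (hasDerivAt_max_zero_pow (n := 2 * m) (by omega) (t - k * τ)).comp_sub_const t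
      ((k : ℝ) * τ)
    convert! (hd.const_mul ((m.choose k : ℝ) * a ^ (m - k) * b ^ k)).div_const
      ((2 * m + 1).factorial : ℝ) using 1
    rw [Nat.factorial_succ]
    push_cast
    field_simp
  · simpa [hkm] using hasDerivAt_const t (0 : ℝ)

theorem smoothTerm_of_nonneg (τ a b : ℝ) {t : ℝ} (ht : 0 ≤ t) (p : ℕ × ℕ) :
    smoothTerm τ a b t p = Sterm τ a b t p.1 p.2 := by
  unfold smoothTerm
  split_ifs with h
  · subst h
    simp [Sterm, ht]
  · rfl

theorem Sterm_zero {τ : ℝ} (hτ : 0 ≤ τ) (a b : ℝ) (k m : ℕ) : Sterm τ a b 0 k m = 0 := by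
  have : 0 ≤ (k : ℝ) * τ := by positivity
  simp [Sterm, this]

theorem summable_choose_mul_pow_div_factorial {x y R : ℝ} (hx : 0 ≤ x) (hy : 0 ≤ y)
    (hR : 0 ≤ R) :
    Summable fun p : ℕ × ℕ => (p.2.choose p.1 : ℝ) * x ^ (p.2 - p.1) * y ^ p.1 * R ^ (2 * p.2) /
      ((2 * p.2).factorial : ℝ) := by
  rw [← (Equiv.prodComm ℕ ℕ).summable_iff, summable_prod_of_nonneg]
  · have hs (m k : ℕ) (hk : k ∉ Finset.range (m + 1)) :
        (m.choose k : ℝ) * x ^ (m - k) * y ^ k * R ^ (2 * m) / ((2 * m).factorial : ℝ) = 0 := by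
      rw [Nat.choose_eq_zero_of_lt (by rw [Finset.mem_range] at hk; omega)]
      simp
    refine ⟨fun m => summable_of_ne_finset_zero (s := Finset.range (m + 1)) (hs m), ?_⟩
    refine (Real.summable_pow_div_factorial ((x + y) * R ^ 2)).of_nonneg_of_le
      (fun m => tsum_nonneg fun k => by simp; positivity) fun m => ?_
    simp only [Function.comp_apply, Equiv.prodComm_apply, Prod.swap]
    rw [tsum_eq_sum (hs m), ← Finset.sum_div, ← Finset.sum_mul]
    have : ∑ k ∈ Finset.range (m + 1), (m.choose k : ℝ) * x ^ (m - k) * y ^ k = (x + y) ^ m := by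
      rw [add_comm x y, add_pow]
      exact Finset.sum_congr rfl fun k _ => by ring
    rw [this, mul_pow, ← pow_mul]
    have hf : m.factorial ≤ (2 * m).factorial := Nat.factorial_le (by omega)
    gcongr
  · intro p
    simp
    positivity

theorem norm_Cterm_le {τ : ℝ} (hτ : 0 ≤ τ) (a b : ℝ) {t R : ℝ} (hR : 0 ≤ R) (ht : t ≤ R)
    (p : ℕ × ℕ) :
    ‖Cterm τ a b t p.1 p.2‖ ≤ (p.2.choose p.1 : ℝ) * |a| ^ (p.2 - p.1) * |b| ^ p.1 *
      R ^ (2 * p.2) / ((2 * p.2).factorial : ℝ) := by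
  unfold Cterm
  split_ifs
  · have h : max (t - (p.1 : ℝ) * τ) 0 ≤ R :=
      max_le (by have : 0 ≤ (p.1 : ℝ) * τ := by positivity
                 linarith) hR
    have h' : 0 ≤ max (t - (p.1 : ℝ) * τ) 0 := le_max_right _ _
    simp only [norm_div, norm_mul, norm_pow, Real.norm_eq_abs, Nat.abs_cast, abs_of_nonneg h']
    gcongr
  · simp
    positivity

theorem summable_smoothTerm_zero {τ : ℝ} (hτ : 0 ≤ τ) (a b : ℝ) :
    Summable (smoothTerm τ a b 0) := by
  have : smoothTerm τ a b 0 = fun _ => 0 := by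
    ext p
    rw [smoothTerm_of_nonneg τ a b le_rfl, Sterm_zero hτ]
  rw [this]
  exact summable_zero

theorem hasDerivAt_tsum_smoothTerm {τ : ℝ} (hτ : 0 ≤ τ) (a b t : ℝ) :
    HasDerivAt (fun x => ∑' p, smoothTerm τ a b x p) (∑' p : ℕ × ℕ, Cterm τ a b t p.1 p.2) t := by
  have hR : 0 ≤ |t| + 1 := by positivity
  refine hasDerivAt_tsum_of_isPreconnected (t := Iio (|t| + 1)) (y₀ := 0)
    (summable_choose_mul_pow_div_factorial (abs_nonneg a) (abs_nonneg b) hR) isOpen_Iio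
    isPreconnected_Iio (fun p y _ => hasDerivAt_smoothTerm τ a b y p)
    (fun p y hy => norm_Cterm_le hτ a b hR (le_of_lt hy) p) (by simp; positivity)
    (summable_smoothTerm_zero hτ a b) ?_
  exact lt_of_le_of_lt (le_abs_self t) (lt_add_one _)

theorem continuous_tsum_Cterm {τ : ℝ} (hτ : 0 ≤ τ) (a b : ℝ) :
    Continuous fun t => ∑' p : ℕ × ℕ, Cterm τ a b t p.1 p.2 := by
  rw [continuous_iff_continuousAt]
  intro t
  have hR : 0 ≤ |t| + 1 := by positivity
  refine (continuousOn_tsum (s := Iio (|t| + 1)) (fun p => ?_)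
    (summable_choose_mul_pow_div_factorial (abs_nonneg a) (abs_nonneg b) hR)
    (fun p y hy => norm_Cterm_le hτ a b hR (le_of_lt hy) p)).continuousAt
    (Iio_mem_nhds (lt_of_le_of_lt (le_abs_self t) (lt_add_one _)))
  refine Continuous.continuousOn ?_
  unfold Cterm
  split_ifs <;> fun_prop

theorem Sdel_of_nonneg {τ : ℝ} (hτ : 0 ≤ τ) (a b : ℝ) {t : ℝ} (ht : 0 ≤ t) :
    Sdel τ a b t = ∑' p, smoothTerm τ a b t p := by
  have hR : 0 ≤ |t| + 1 := by positivity
  have hs : Summable (smoothTerm τ a b t) :=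
    summable_of_summable_hasDerivAt_of_isPreconnected
      (g := fun p x => smoothTerm τ a b x p) (t := Iio (|t| + 1)) (y₀ := 0)
      (summable_choose_mul_pow_div_factorial (abs_nonneg a) (abs_nonneg b) hR) isOpen_Iio
      isPreconnected_Iio (fun p y _ => hasDerivAt_smoothTerm τ a b y p)
      (fun p y hy => norm_Cterm_le hτ a b hR (le_of_lt hy) p) (by simp; positivity)
      (summable_smoothTerm_zero hτ a b) (lt_of_le_of_lt (le_abs_self t) (lt_add_one _))
  rw [hs.tsum_prod, Sdel, if_neg ht.not_gt]
  simp only [smoothTerm_of_nonneg τ a b ht]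

theorem deriv_Sdel_of_pos {τ : ℝ} (hτ : 0 ≤ τ) (a b : ℝ) {t : ℝ} (ht : 0 < t) :
    deriv (Sdel τ a b) t = ∑' p : ℕ × ℕ, Cterm τ a b t p.1 p.2 := by
  refine ((hasDerivAt_tsum_smoothTerm hτ a b t).congr_of_eventuallyEq ?_).deriv
  filter_upwards [Ioi_mem_nhds ht] with x hx
  exact Sdel_of_nonneg hτ a b (le_of_lt hx)

/-- The Leibniz rule for a Volterra convolution whose kernel vanishes at `0`. -/
theorem hasDerivAt_integral_convolution {K K' F : ℝ → ℝ} (hK : ∀ x, HasDerivAt K (K' x) x)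
    (hK' : Continuous K') (hF : Continuous F) (hK0 : K 0 = 0) (t : ℝ) :
    HasDerivAt (fun x => ∫ s in (0 : ℝ)..x, K (x - s) * F s)
      (∫ s in (0 : ℝ)..t, K' (t - s) * F s) t := by
  have hKc : Continuous K := continuous_iff_continuousAt.2 fun x => (hK x).continuousAt
  have hx (x y : ℝ) : HasDerivAt (fun x => ∫ s in (0 : ℝ)..x, K (y - s) * F s)
      (K (y - x) * F x) x :=
    (by fun_prop : Continuous fun s => K (y - s) * F s).integral_hasStrictDerivAt 0 x |>.hasDerivAt
  have hy (x y : ℝ) : HasDerivAt (fun y => ∫ s in (0 : ℝ)..x, K (y - s) * F s)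
      (∫ s in (0 : ℝ)..x, K' (y - s) * F s) y := by
    obtain ⟨C, hC⟩ := ((isCompact_closedBall y 1).prod (isCompact_uIcc (a := 0)
      (b := x))).exists_bound_of_continuousOn (f := fun q : ℝ × ℝ => K' (q.1 - q.2) * F q.2) (by fun_prop)
    refine (intervalIntegral.hasDerivAt_integral_of_dominated_loc_of_deriv_le
      (F := fun y s => K (y - s) * F s) (F' := fun y s => K' (y - s) * F s)
      (bound := fun _ => C) (Metric.closedBall_mem_nhds y one_pos)
      (Eventually.of_forall fun z => (by fun_prop :
        Continuous fun s => K (z - s) * F s).aestronglyMeasurable)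
      ((by fun_prop : Continuous fun s => K (y - s) * F s).intervalIntegrable _ _)
      (by fun_prop : Continuous fun s => K' (y - s) * F s).aestronglyMeasurable
      (Eventually.of_forall fun s hs z hz => hC (z, s) ⟨hz, uIoc_subset_uIcc hs⟩)
      intervalIntegrable_const
      (Eventually.of_forall fun s _ z _ => ?_)).2
    exact ((hK (z - s)).comp_sub_const z s).mul_const (F s)
  have hyc : Continuous fun q : ℝ × ℝ => ∫ s in (0 : ℝ)..q.1, K' (q.2 - s) * F s :=
    intervalIntegral.continuous_parametric_intervalIntegral_of_continuous
      (f := fun (q : ℝ × ℝ) s => K' (q.2 - s) * F s) (by fun_prop) continuous_fst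
  have hF2 := hasStrictFDerivAt_uncurry_coprod (u := (t, t))
    (f := fun x y => ∫ s in (0 : ℝ)..x, K (y - s) * F s)
    (f₁ := fun x y => ContinuousLinearMap.toSpanSingleton ℝ (K (y - x) * F x))
    (f₂ := fun x y => ContinuousLinearMap.toSpanSingleton ℝ (∫ s in (0 : ℝ)..x, K' (y - s) * F s))
    (Eventually.of_forall fun v => (hx v.1 v.2).hasFDerivAt)
    (Eventually.of_forall fun v => (hy v.1 v.2).hasFDerivAt)
    ((ContinuousLinearMap.toSpanSingletonCLE (𝕜 := ℝ) (E := ℝ)).continuous.comp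
      (by fun_prop : Continuous fun q : ℝ × ℝ => K (q.2 - q.1) * F q.1)).continuousAt
    ((ContinuousLinearMap.toSpanSingletonCLE (𝕜 := ℝ) (E := ℝ)).continuous.comp hyc).continuousAt
  have h := hF2.hasFDerivAt.comp_hasDerivAt (f := fun x => (x, x)) t
    ((hasDerivAt_id' t).prodMk (hasDerivAt_id' t))
  simpa [Function.HasUncurry.uncurry, Function.comp_def, hK0] using h

/-- for `f ∈ C([0,T])` (`T = Nτ`) and
`y_p(t) = ∫_0^t S_τ^{a,b}(t-s)·f(s) ds` on `[0,T]`, `y_p` is differentiable on `(0,T]`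
(within `[0,T]`) with derivative `∫_0^t (S_τ^{a,b})'(t-s)·f(s) ds`, its derivative is
continuous on `[0,T]`, and `y_p(0) = 0`, `y_p'(0) = 0` (one-sided). -/
theorem particular_solution_first_derivative (τ : ℝ) (hτ : 0 < τ) (N : ℕ)
    (T : ℝ) (hT : T = (N : ℝ) * τ) (a b : ℝ)
    (f : ℝ → ℝ) (hf : ContinuousOn f (Set.Icc (0 : ℝ) T))
    (yp : ℝ → ℝ)
    (hyp : ∀ t ∈ Set.Icc (0 : ℝ) T, yp t = ∫ s in (0 : ℝ)..t, Sdel τ a b (t - s) * f s) :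
    (∀ t ∈ Set.Ioc (0 : ℝ) T,
      HasDerivWithinAt yp (∫ s in (0 : ℝ)..t, deriv (Sdel τ a b) (t - s) * f s)
        (Set.Icc (0 : ℝ) T) t) ∧
    ContinuousOn (derivWithin yp (Set.Icc (0 : ℝ) T)) (Set.Icc (0 : ℝ) T) ∧
    yp 0 = 0 ∧
    HasDerivWithinAt yp 0 (Set.Icc (0 : ℝ) T) 0 := by
  have hT0 : 0 ≤ T := by rw [hT]; positivity
  set K : ℝ → ℝ := fun t => ∑' p, smoothTerm τ a b t p with hKdef
  set K' : ℝ → ℝ := fun t => ∑' p : ℕ × ℕ, Cterm τ a b t p.1 p.2 with hK'def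
  have hK' : Continuous K' := continuous_tsum_Cterm hτ.le a b
  have hK0 : K 0 = 0 := by
    rw [hKdef]
    simp [smoothTerm_of_nonneg, Sterm_zero hτ.le]
  let F : ℝ → ℝ := IccExtend hT0 ((Icc 0 T).domRestrict f)
  have hF : Continuous F := hf.domRestrict.Icc_extend'
  have hFf {s t : ℝ} (ht : t ∈ Icc 0 T) (hs : s ∈ uIoc 0 t) : F s = f s := by
    rw [uIoc_of_le ht.1] at hs
    exact IccExtend_of_mem hT0 _ ⟨hs.1.le, hs.2.trans ht.2⟩
  have hY (t : ℝ) (ht : t ∈ Icc 0 T) : yp t = ∫ s in (0 : ℝ)..t, K (t - s) * F s := by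
    rw [hyp t ht]
    refine intervalIntegral.integral_congr_ae (Eventually.of_forall fun s hs => ?_)
    rw [hFf ht hs]
    rw [uIoc_of_le ht.1] at hs
    rw [Sdel_of_nonneg hτ.le a b (sub_nonneg.2 hs.2)]
  have hZ (t : ℝ) (ht : t ∈ Icc 0 T) :
      ∫ s in (0 : ℝ)..t, deriv (Sdel τ a b) (t - s) * f s = ∫ s in (0 : ℝ)..t, K' (t - s) * F s := by
    refine intervalIntegral.integral_congr_ae ?_
    filter_upwards [Measure.ae_ne volume t] with s hst hs
    rw [hFf ht hs]
    rw [uIoc_of_le ht.1] at hs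
    rw [deriv_Sdel_of_pos hτ.le a b (sub_pos.2 (hs.2.lt_of_ne hst))]
  have hd (t : ℝ) (ht : t ∈ Icc 0 T) :
      HasDerivWithinAt yp (∫ s in (0 : ℝ)..t, K' (t - s) * F s) (Icc 0 T) t :=
    (hasDerivAt_integral_convolution (hasDerivAt_tsum_smoothTerm hτ.le a b) hK' hF hK0
      t).hasDerivWithinAt.congr hY (hY t ht)
  have h0 : (0 : ℝ) ∈ Icc 0 T := ⟨le_rfl, hT0⟩
  refine ⟨fun t ht => ?_, ?_, by simp [hY 0 h0], by simpa using hd 0 h0⟩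
  · rw [hZ t (Ioc_subset_Icc_self ht)]
    exact hd t (Ioc_subset_Icc_self ht)
  · rcases hT0.eq_or_lt with h | h
    · rw [← h, Icc_self]
      exact continuousOn_singleton _ _
    · have hc : Continuous fun t => ∫ s in (0 : ℝ)..t, K' (t - s) * F s :=
        intervalIntegral.continuous_parametric_intervalIntegral_of_continuous
          (f := fun (t : ℝ) s => K' (t - s) * F s) (by fun_prop) continuous_id
      exact hc.continuousOn.congr fun t ht => (hd t ht).derivWithin (uniqueDiffOn_Icc h t ht)
end
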